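/- arXiv:2009.09394 — 3 statements merged into one kernel-verified Lean document; each statement's English description precedes it below -/
import Mathlib

section
/- For a simple graph G on a vertex type V and a vertex x : V, the neighbor set of x in G is finite if and only if there exist a type W, a simple graph H on W, a graph embedding f : G ↪g H, and a vertex n : W such that, writing S for the set of H-neighbors of n: (i) the induced subgraph of H on S is connected; (ii) there exist distinct s e ∈ S such that s and e each have exactly one H-neighbor belonging to S, while every element of S other than s and e has exactly two H-neighbors belonging to S; and (iii) every H-neighbor v of f x has exactly one H-neighbor belonging to S, and distinct H-neighbors of f x have distinct unique H-neighbors in S. -/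
universe u

/-- A two-element set containing `a ≠ b` contains nothing else. -/
theorem Set.eq_or_eq_of_ncard_eq_two {α : Type*} {A : Set α} {a b c : α}
    (hA : A.ncard = 2) (ha : a ∈ A) (hb : b ∈ A) (hc : c ∈ A) (hab : a ≠ b) :
    c = a ∨ c = b := by
  obtain ⟨p, q, -, rfl⟩ := Set.ncard_eq_two.1 hA
  simp only [Set.mem_insert_iff, Set.mem_singleton_iff] at ha hb hc
  grind

theorem Set.eq_of_ncard_eq_one {α : Type*} {A : Set α} {a b : α}
    (hA : A.ncard = 1) (ha : a ∈ A) (hb : b ∈ A) : a = b := by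
  obtain ⟨p, rfl⟩ := Set.ncard_eq_one.1 hA
  exact ha.trans hb.symm

namespace SimpleGraph

/-- A nonempty set of vertices closed under adjacency in a preconnected graph is everything. -/
theorem Preconnected.mem_of_adj_closed {W : Type*} {K : SimpleGraph W} (hK : K.Preconnected)
    {A : Set W} (hA : ∀ a ∈ A, ∀ b, K.Adj a b → b ∈ A) {a : W} (ha : a ∈ A) (b : W) :
    b ∈ A := by
  obtain ⟨p⟩ := hK a b
  induction p with
  | nil => exact ha
  | cons h _ ih => exact ih (hA _ ha _ h)

/-- A connected graph with two distinct vertices of degree one in which all other vertices have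
degree two is finite. -/
theorem Preconnected.finite_of_ncard_neighborSet {W : Type*} {K : SimpleGraph W}
    (hK : K.Preconnected) {s e : W} (hse : s ≠ e) (hs : (K.neighborSet s).ncard = 1)
    (he : (K.neighborSet e).ncard = 1)
    (h : ∀ t, t ≠ s → t ≠ e → (K.neighborSet t).ncard = 2) : Finite W := by
  classical
  obtain ⟨p, hp⟩ := (hK s e).exists_isPath
  have hlen : 0 < p.length := by
    rcases Nat.eq_zero_or_pos p.length with h0 | h0
    · exact absurd (Walk.eq_of_length_eq_zero h0) hse
    · exact h0
  have hclosed : ∀ a ∈ {w | w ∈ p.support}, ∀ b, K.Adj a b → b ∈ {w | w ∈ p.support} := by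
    intro a ha b hab
    obtain ⟨i, rfl, hi⟩ := Walk.mem_support_iff_exists_getVert.1 ha
    have next : ∀ j, j < p.length → K.Adj (p.getVert j) (p.getVert (j + 1)) :=
      fun j hj => p.adj_getVert_succ hj
    rcases Nat.eq_zero_or_pos i with rfl | hi0
    · have h1 := next 0 hlen
      rw [Walk.getVert_zero] at hab h1
      rw [Set.eq_of_ncard_eq_one hs hab h1]
      exact p.getVert_mem_support _
    · obtain ⟨j, rfl⟩ : ∃ j, i = j + 1 := ⟨i - 1, by omega⟩
      have h1 := (next j (by omega)).symm
      rcases hi.eq_or_lt with hi | hi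
      · rw [hi, Walk.getVert_length] at hab h1
        rw [Set.eq_of_ncard_eq_one he hab h1]
        exact p.getVert_mem_support _
      · have h2 := next (j + 1) hi
        have inj := hp.getVert_injOn
        have hns : p.getVert (j + 1) ≠ s := by
          intro hc
          have := inj (show j + 1 ≤ p.length by omega) (show 0 ≤ p.length by omega)
            (hc.trans p.getVert_zero.symm)
          omega
        have hne : p.getVert (j + 1) ≠ e := by
          intro hc
          have := inj (show j + 1 ≤ p.length by omega) (show p.length ≤ p.length by omega)
            (hc.trans p.getVert_length.symm)
          omega
        have hd : p.getVert j ≠ p.getVert (j + 1 + 1) := by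
          intro hc
          have := inj (show j ≤ p.length by omega) (show j + 1 + 1 ≤ p.length by omega) hc
          omega
        rcases Set.eq_or_eq_of_ncard_eq_two (h _ hns hne) h1 h2 hab hd with rfl | rfl <;>
          exact p.getVert_mem_support _
  have huniv : (Set.univ : Set W) ⊆ {w | w ∈ p.support} := fun b _ =>
    hK.mem_of_adj_closed hclosed (a := s) p.start_mem_support b
  exact Set.finite_univ_iff.1 ((List.finite_toSet p.support).subset huniv)

theorem ncard_neighborSet_induce {W : Type*} (H : SimpleGraph W) (S : Set W) (t : S) :
    ((H.induce S).neighborSet t).ncard = (H.neighborSet t ∩ S).ncard := by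
  rw [← Set.ncard_image_of_injective _ Subtype.val_injective]
  congr 1
  ext w
  simp

/-- Adjacency in the disjoint union of `G` with the path `1, …, m`, a vertex `0` joined to that
path, and edges from each neighbor `a` of `x` to the path vertex `g a`. -/
def fanAdj {V : Type u} (G : SimpleGraph V) (x : V) (g : V → ℕ) (m : ℕ) :
    V ⊕ ULift.{u} ℕ → V ⊕ ULift.{u} ℕ → Prop
  | .inl a, .inl b => G.Adj a b
  | .inl a, .inr i => G.Adj x a ∧ g a = i.down
  | .inr i, .inl a => G.Adj x a ∧ g a = i.down
  | .inr i, .inr j =>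
    (i.down = 0 ∧ 1 ≤ j.down ∧ j.down ≤ m) ∨ (j.down = 0 ∧ 1 ≤ i.down ∧ i.down ≤ m) ∨
      (1 ≤ i.down ∧ i.down ≤ m ∧ 1 ≤ j.down ∧ j.down ≤ m ∧
        (i.down + 1 = j.down ∨ j.down + 1 = i.down))

/-- The extension of `G` by a fan whose path has `m` vertices, each neighbor `a` of `x` being
attached to the path vertex `g a`. -/
def fanExtension {V : Type u} (G : SimpleGraph V) (x : V) (g : V → ℕ) (m : ℕ) :
    SimpleGraph (V ⊕ ULift.{u} ℕ) where
  Adj := fanAdj G x g m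
  symm := ⟨by
    rintro (a | i) (b | j) h
    · exact Adj.symm (G := G) h
    · exact h
    · exact h
    · simp only [fanAdj] at h ⊢
      omega⟩
  loopless := ⟨by
    rintro (a | i) h
    · exact G.loopless.irrefl a h
    · simp only [fanAdj] at h
      omega⟩

section fanExtension

variable {V : Type u} {G : SimpleGraph V} {x : V} {g : V → ℕ} {m : ℕ}

theorem mem_neighborSet_fan_center (hg : ∀ a, G.Adj x a → 1 ≤ g a) {w : V ⊕ ULift.{u} ℕ} :
    w ∈ (fanExtension G x g m).neighborSet (.inr ⟨0⟩) ↔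
      ∃ j, 1 ≤ j ∧ j ≤ m ∧ w = .inr ⟨j⟩ := by
  rcases w with a | j
  · simp only [mem_neighborSet, fanExtension, fanAdj, reduceCtorEq, and_false, exists_false,
      iff_false]
    rintro ⟨h, h'⟩
    have := hg a h
    omega
  · simp only [mem_neighborSet, fanExtension, fanAdj]
    constructor
    · intro h
      exact ⟨j.down, by omega, by omega, rfl⟩
    · rintro ⟨_, h1, h2, h⟩
      cases h
      exact Or.inl ⟨trivial, h1, h2⟩

theorem fanExtension_adj_inr {i j : ℕ} (hi : 1 ≤ i) (him : i ≤ m) (hj : 1 ≤ j) (hjm : j ≤ m) :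
    (fanExtension G x g m).Adj (.inr ⟨i⟩) (.inr ⟨j⟩) ↔ i + 1 = j ∨ j + 1 = i := by
  simp only [fanExtension, fanAdj]
  omega

theorem fanExtension_path_connected (hg : ∀ a, G.Adj x a → 1 ≤ g a) (hm : 1 ≤ m) :
    ((fanExtension G x g m).induce
      ((fanExtension G x g m).neighborSet (.inr ⟨0⟩))).Connected := by
  rw [connected_iff_exists_forall_reachable]
  refine ⟨⟨.inr ⟨1⟩, (mem_neighborSet_fan_center hg).2 ⟨1, le_rfl, hm, rfl⟩⟩, ?_⟩
  rintro ⟨w, hw⟩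
  obtain ⟨j, hj, hjm, rfl⟩ := (mem_neighborSet_fan_center hg).1 hw
  induction j, hj using Nat.le_induction with
  | base => exact Reachable.refl _
  | succ j hj ih =>
    have hj' := (mem_neighborSet_fan_center (m := m) hg).2 ⟨j, hj, by omega, rfl⟩
    refine (ih (by omega) hj').trans (Adj.reachable ?_)
    exact (fanExtension_adj_inr (G := G) (x := x) (g := g) hj (by omega) (by omega) hjm).2 (Or.inl rfl)

end fanExtension

end SimpleGraph

open SimpleGraph in
theorem finite_degree_iff_modal {V : Type u} (G : SimpleGraph V) (x : V) :
    (G.neighborSet x).Finite ↔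
      ∃ (W : Type u) (H : SimpleGraph W) (f : G ↪g H) (n : W),
        (H.induce (H.neighborSet n)).Connected ∧
        (∃ s ∈ H.neighborSet n, ∃ e ∈ H.neighborSet n, s ≠ e ∧
          (H.neighborSet s ∩ H.neighborSet n).ncard = 1 ∧
          (H.neighborSet e ∩ H.neighborSet n).ncard = 1 ∧
          ∀ t ∈ H.neighborSet n, t ≠ s → t ≠ e →
            (H.neighborSet t ∩ H.neighborSet n).ncard = 2) ∧
        (∀ v : W, H.Adj (f x) v →
          (H.neighborSet v ∩ H.neighborSet n).ncard = 1) ∧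
        (∀ v₁ v₂ : W, H.Adj (f x) v₁ → H.Adj (f x) v₂ →
          ∀ w ∈ H.neighborSet n, H.Adj v₁ w → H.Adj v₂ w → v₁ = v₂) := by
  constructor
  · intro hfin
    obtain ⟨g₀, hg₀⟩ := Set.countable_iff_exists_injOn.1 hfin.countable
    obtain ⟨B, hB⟩ := (hfin.image g₀).bddAbove
    have hgB : ∀ a, G.Adj x a → g₀ a ≤ B := fun a ha => hB ⟨a, ha, rfl⟩
    set g : V → ℕ := fun a => g₀ a + 1 with hgdef
    have hg : ∀ a, G.Adj x a → 1 ≤ g a := fun a _ => Nat.le_add_left 1 _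
    set H := fanExtension G x g (B + 2)
    have hmem : ∀ w, w ∈ H.neighborSet (.inr ⟨0⟩) ↔ ∃ j, 1 ≤ j ∧ j ≤ B + 2 ∧ w = .inr ⟨j⟩ :=
      fun w => mem_neighborSet_fan_center hg
    have hadj : ∀ i j, 1 ≤ i → i ≤ B + 2 → 1 ≤ j → j ≤ B + 2 →
        (H.Adj (.inr ⟨i⟩) (.inr ⟨j⟩) ↔ i + 1 = j ∨ j + 1 = i) :=
      fun i j hi him hj hjm => fanExtension_adj_inr hi him hj hjm
    have hx : ∀ v, H.Adj (.inl x) v → ∃ a, G.Adj x a ∧ v = .inl a := by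
      rintro (a | i) h
      · exact ⟨a, h, rfl⟩
      · exact absurd h.1 (G.loopless.irrefl x)
    refine ⟨V ⊕ ULift.{u} ℕ, H, ⟨⟨Sum.inl, Sum.inl_injective⟩, Iff.rfl⟩, .inr ⟨0⟩,
      fanExtension_path_connected hg (by omega),
      ⟨.inr ⟨1⟩, (hmem _).2 ⟨1, by omega, by omega, rfl⟩,
        .inr ⟨B + 2⟩, (hmem _).2 ⟨B + 2, by omega, by omega, rfl⟩, by simp, ?_, ?_, ?_⟩, ?_, ?_⟩
    · refine Set.ncard_eq_one.2 ⟨.inr ⟨2⟩, ?_⟩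
      ext w
      simp only [Set.mem_inter_iff, hmem, mem_neighborSet, Set.mem_singleton_iff]
      constructor
      · rintro ⟨h, j, h1, h2, rfl⟩
        rw [hadj _ _ (by omega) (by omega) h1 h2] at h
        obtain rfl : j = 2 := by omega
        rfl
      · rintro rfl
        exact ⟨(hadj _ _ (by omega) (by omega) (by omega) (by omega)).2 (by omega),
          2, by omega, by omega, rfl⟩
    · refine Set.ncard_eq_one.2 ⟨.inr ⟨B + 1⟩, ?_⟩
      ext w
      simp only [Set.mem_inter_iff, hmem, mem_neighborSet, Set.mem_singleton_iff]
      constructor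
      · rintro ⟨h, j, h1, h2, rfl⟩
        rw [hadj _ _ (by omega) (by omega) h1 h2] at h
        obtain rfl : j = B + 1 := by omega
        rfl
      · rintro rfl
        exact ⟨(hadj _ _ (by omega) (by omega) (by omega) (by omega)).2 (by omega),
          B + 1, by omega, by omega, rfl⟩
    · intro t ht hts hte
      obtain ⟨i, hi1, hi2, rfl⟩ := (hmem t).1 ht
      have hi1' : i ≠ 1 := fun h => hts (by rw [h])
      have hi2' : i ≠ B + 2 := fun h => hte (by rw [h])
      refine Set.ncard_eq_two.2 ⟨.inr ⟨i - 1⟩, .inr ⟨i + 1⟩, by simp, ?_⟩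
      ext w
      simp only [Set.mem_inter_iff, hmem, mem_neighborSet, Set.mem_singleton_iff,
        Set.mem_insert_iff]
      constructor
      · rintro ⟨h, j, h1, h2, rfl⟩
        rw [hadj _ _ (by omega) (by omega) h1 h2] at h
        simp only [Sum.inr.injEq, ULift.up.injEq]
        omega
      · rintro (rfl | rfl)
        · exact ⟨(hadj _ _ (by omega) (by omega) (by omega) (by omega)).2 (by omega),
            i - 1, by omega, by omega, rfl⟩
        · exact ⟨(hadj _ _ (by omega) (by omega) (by omega) (by omega)).2 (by omega),
            i + 1, by omega, by omega, rfl⟩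
    · intro v hv
      obtain ⟨a, ha, rfl⟩ := hx v hv
      refine Set.ncard_eq_one.2 ⟨.inr ⟨g a⟩, ?_⟩
      ext w
      simp only [Set.mem_inter_iff, hmem, mem_neighborSet, Set.mem_singleton_iff]
      constructor
      · rintro ⟨h, j, h1, h2, rfl⟩
        have h' : g a = j := h.2
        rw [h']
      · rintro rfl
        have := hgB a ha
        exact ⟨⟨ha, rfl⟩, g a, hg a ha, by simp only [hgdef]; omega, rfl⟩
    · intro v₁ v₂ hv₁ hv₂ w hw h₁ h₂
      obtain ⟨a, ha, rfl⟩ := hx v₁ hv₁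
      obtain ⟨b, hb, rfl⟩ := hx v₂ hv₂
      obtain ⟨j, -, -, rfl⟩ := (hmem w).1 hw
      have e₁ : g₀ a + 1 = j := h₁.2
      have e₂ : g₀ b + 1 = j := h₂.2
      rw [hg₀ ha hb (by omega)]
  · rintro ⟨W, H, f, n, hconn, ⟨s, hs, e, he, hse, hs1, he1, h2⟩, hone, hinj⟩
    have hS : Finite (H.neighborSet n) := by
      refine hconn.preconnected.finite_of_ncard_neighborSet (s := ⟨s, hs⟩) (e := ⟨e, he⟩)
        (by simpa using hse) ?_ ?_ ?_
      · rw [ncard_neighborSet_induce]; exact hs1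
      · rw [ncard_neighborSet_induce]; exact he1
      · intro t hts hte
        rw [ncard_neighborSet_induce]
        exact h2 t t.2 (fun h => hts (Subtype.ext h)) (fun h => hte (Subtype.ext h))
    have hex : ∀ v : G.neighborSet x, ∃ w : H.neighborSet n, H.Adj (f v) w := by
      intro v
      obtain ⟨w, hw⟩ := Set.ncard_eq_one.1 (hone (f v) (f.map_adj_iff.2 v.2))
      have hw' : w ∈ H.neighborSet (f v) ∩ H.neighborSet n := hw ▸ Set.mem_singleton w
      exact ⟨⟨w, hw'.2⟩, hw'.1⟩
    choose φ hφ using hex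
    have hφinj : Function.Injective φ := fun a b hab =>
      Subtype.ext (f.injective (hinj _ _ (f.map_adj_iff.2 a.2) (f.map_adj_iff.2 b.2) (φ a)
        (φ a).2 (hφ a) (hab ▸ hφ b)))
    exact Set.finite_coe_iff.1 (Finite.of_injective φ hφinj)
end

section
/- Let L be a first-order language, T an L-theory, and let M and H be L-structures that are models of T with an L-embedding f : M ↪[L] H. Suppose M is existentially closed in Mod(T): for every L-structure N that models T, every L-embedding g : M ↪[L] N, all m n : ℕ, every quantifier-free bounded formula ψ : L.BoundedFormula (Fin m) n, and every valuation xs : Fin m → M, if ψ.exs is realized in N at g ∘ xs then ψ.exs is realized in M at xs. Then there exist an L-structure P that models T, an L-elementary embedding j : M ↪ₑ[L] P, and an L-embedding k : H ↪[L] P such that k (f x) = j x for all x : M. -/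
namespace FirstOrder.Language

open Filter

variable {L : Language} {M H : Type*} [L.Structure M] [L.Structure H]

/-- The truth value of a bounded formula depends only on the values of its free variables. -/
theorem BoundedFormula.realize_congr_of_eqOn_freeVarFinset {α : Type*} [DecidableEq α] {n : ℕ}
    (φ : L.BoundedFormula α n) {v w : α → M} (xs : Fin n → M)
    (h : Set.EqOn v w φ.freeVarFinset) : φ.Realize v xs ↔ φ.Realize w xs := by
  rw [← realize_restrictFreeVar' subset_rfl (v := v), ← realize_restrictFreeVar' subset_rfl (v := w)]
  exact iff_of_eq (congrArg (BoundedFormula.Realize _ · xs) (funext fun a => h a.2))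

/-- A finite set can be enumerated so that the index of an element is a function defined on the
whole ambient type. -/
theorem _root_.Finset.exists_fin_leftInvOn {α : Type*} (s : Finset α) :
    ∃ (n : ℕ) (e : α → Fin n) (y : Fin n → α), Set.LeftInvOn y e s := by
  classical
  rcases isEmpty_or_nonempty α with _ | ⟨⟨a⟩⟩
  · exact ⟨0, isEmptyElim, Fin.elim0, fun b => isEmptyElim b⟩
  · let t := insert a s
    refine ⟨t.card, fun b => if hb : b ∈ t then t.equivFin ⟨b, hb⟩ else
      t.equivFin ⟨a, Finset.mem_insert_self a s⟩, fun i => t.equivFin.symm i, fun b hb => ?_⟩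
    have hb' : b ∈ t := Finset.mem_insert_of_mem hb
    simp [hb']

/-- If `M` reflects existential formulas along `f : M ↪[L] H`, then every quantifier-free formula
with parameters true in `H` is true in `M` for some retraction of `f` on the parameters. -/
theorem Embedding.exists_leftInverse_realize (f : M ↪[L] H)
    (hf : ∀ (m n : ℕ) (ψ : L.BoundedFormula (Fin m) n), ψ.IsQF →
      ∀ xs : Fin m → M, ψ.exs.Realize (f ∘ xs) → ψ.exs.Realize xs)
    (φ : L.Formula H) (hφ : φ.IsQF) (h : φ.Realize id) :
    ∃ a : H → M, Function.LeftInverse a f ∧ φ.Realize a := by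
  classical
  obtain ⟨n, e, ys, he⟩ := φ.freeVarFinset.exists_fin_leftInvOn
  obtain ⟨m, d, xs, hd⟩ := (φ.freeVarFinset.preimage f f.injective.injOn).exists_fin_leftInvOn
  let g : H → Fin m ⊕ Fin n := fun b => if hb : ∃ x, f x = b then .inl (d hb.choose) else .inr (e b)
  have hH : (BoundedFormula.relabel g φ).exs.Realize (f ∘ xs) := by
    refine BoundedFormula.realize_exs.2 ⟨ys, BoundedFormula.realize_relabel.2 ?_⟩
    rw [Formula.boundedFormula_realize_eq_realize]
    refine (BoundedFormula.realize_congr_of_eqOn_freeVarFinset φ _ fun b hb => ?_).1 h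
    by_cases hx : ∃ x, f x = b
    · have hx' : xs (d hx.choose) = hx.choose := hd (by simpa [hx.choose_spec] using hb)
      simp [g, hx, hx', hx.choose_spec]
    · simpa [g, hx] using (he hb).symm
  obtain ⟨zs, hzs⟩ := BoundedFormula.realize_exs.1 (hf m n _ (hφ.relabel g) xs hH)
  have hM := BoundedFormula.realize_relabel.1 hzs
  rw [Formula.boundedFormula_realize_eq_realize] at hM
  refine ⟨fun b => if hb : ∃ x, f x = b then hb.choose else zs (e b), fun x => ?_,
    (BoundedFormula.realize_congr_of_eqOn_freeVarFinset φ _ fun b hb => ?_).1 hM⟩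
  · have hx : ∃ y, f y = f x := ⟨x, rfl⟩
    simpa only [dif_pos hx] using f.injective hx.choose_spec
  · by_cases hx : ∃ x, f x = b
    · have hx' : xs (d hx.choose) = hx.choose := hd (by simpa [hx.choose_spec] using hb)
      simp [g, hx, hx']
    · simp [g, hx]

/-- If `M` reflects existential formulas along `f : M ↪[L] H`, then some ultrafilter on the
retractions of `f` contains the truth set of each quantifier-free formula with parameters that
holds in `H`. -/
theorem Embedding.exists_ultrafilter_leftInverse (f : M ↪[L] H)
    (hf : ∀ (m n : ℕ) (ψ : L.BoundedFormula (Fin m) n), ψ.IsQF →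
      ∀ xs : Fin m → M, ψ.exs.Realize (f ∘ xs) → ψ.exs.Realize xs) :
    ∃ u : Ultrafilter {a : H → M // Function.LeftInverse a f},
      ∀ φ : L.Formula H, φ.IsQF →
        (φ.Realize id ↔ ∀ᶠ a : {a : H → M // Function.LeftInverse a f} in u, φ.Realize a.1) := by
  let B : FilterBasis {a : H → M // Function.LeftInverse a f} :=
    { sets := {s | ∃ φ : L.Formula H, φ.IsQF ∧ φ.Realize id ∧ s = {a | φ.Realize a.1}}
      nonempty := ⟨_, ⊤, .top, Formula.realize_top.2 trivial, rfl⟩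
      inter_sets := by
        rintro _ _ ⟨φ, hφ, hφH, rfl⟩ ⟨ψ, hψ, hψH, rfl⟩
        refine ⟨_, ⟨φ ⊓ ψ, hφ.inf hψ, Formula.realize_inf.2 ⟨hφH, hψH⟩, rfl⟩, fun a ha => ?_⟩
        exact Formula.realize_inf.1 ha }
  have hB : B.filter.NeBot := by
    refine B.hasBasis.neBot_iff.2 ?_
    rintro _ ⟨φ, hφ, hφH, rfl⟩
    obtain ⟨a, ha, haφ⟩ := f.exists_leftInverse_realize hf φ hφ hφH
    exact ⟨⟨a, ha⟩, haφ⟩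
  have key : ∀ φ : L.Formula H, φ.IsQF → φ.Realize id →
      ∀ᶠ a : {a : H → M // Function.LeftInverse a f} in Ultrafilter.of B.filter,
        φ.Realize a.1 := fun φ hφ hφH =>
    Ultrafilter.of_le B.filter (B.mem_filter_of_mem ⟨φ, hφ, hφH, rfl⟩)
  refine ⟨Ultrafilter.of B.filter, fun φ hφ => ⟨key φ hφ, fun h => ?_⟩⟩
  by_contra hn
  have hnot := key φ.not hφ.not (Formula.realize_not.2 hn)
  simp only [Formula.realize_not] at hnot
  exact Ultrafilter.eventually_not.1 hnot h

/-- The diagonal embedding of a structure into an ultrapower is elementary. -/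
def Ultraproduct.diagonal [Nonempty M] {I : Type*} (u : Ultrafilter I) :
    M ↪ₑ[L] (u : Filter I).Product fun _ => M where
  toFun x := ((fun _ => x : I → M) : (u : Filter I).Product fun _ => M)
  map_formula' _ φ x := by
    refine (Ultraproduct.realize_formula_cast φ fun i _ => x i).trans ?_
    exact eventually_const

/-- A family of maps `H → M` induces an embedding of `H` into an ultrapower of `M` when the
quantifier-free formulas true in `H` are those which the family eventually satisfies. -/
def Ultraproduct.embeddingOfRealizeIff {I : Type*} (u : Ultrafilter I) (a : I → H → M)
    (h : ∀ φ : L.Formula H, φ.IsQF → (φ.Realize id ↔ ∀ᶠ i : I in u, φ.Realize (a i))) :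
    H ↪[L] (u : Filter I).Product fun _ => M where
  toFun b := ((fun i => a i b : I → M) : (u : Filter I).Product fun _ => M)
  inj' b c hbc := by
    have := h ((Term.var b).equal (Term.var c)) (BoundedFormula.IsAtomic.equal _ _).isQF
    simp only [Formula.realize_equal, Term.realize_var] at this
    exact this.2 (Quotient.eq''.1 hbc)
  map_fun' {n} F x := by
    refine Eq.trans ?_ (Ultraproduct.funMap_cast F fun k i => a i (x k)).symm
    have := h ((Term.var (Structure.funMap F x)).equal (Term.func F fun k => Term.var (x k)))
      (BoundedFormula.IsAtomic.equal _ _).isQF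
    simp only [Formula.realize_equal, Term.realize_var, Term.realize_func] at this
    exact Quotient.sound' (this.1 rfl)
  map_rel' {n} r x := by
    have := h (r.formula fun k => Term.var (x k)) (BoundedFormula.IsAtomic.rel _ _).isQF
    simp only [Formula.realize_rel, Term.realize_var] at this
    refine Iff.trans ?_ this.symm
    exact relMap_quotient_mk' (s := (u : Filter I).productSetoid fun _ => M) r
      fun k i => a i (x k)

/-- An embedding into an empty structure is invertible. -/
def Embedding.symmOfIsEmpty [IsEmpty H] (f : M ↪[L] H) : H ↪[L] M where
  toFun := isEmptyElim
  inj' b := isEmptyElim b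
  map_fun' F x := isEmptyElim (Structure.funMap F x)
  map_rel' r x := by
    rw [← f.map_rel r]
    exact iff_of_eq (congrArg _ (funext fun i => isEmptyElim (x i)))

end FirstOrder.Language

open FirstOrder

universe u

theorem existentiallyClosed_amalgamation {L : Language} {M H : Type u}
    [L.Structure M] [L.Structure H] {T : L.Theory}
    (hM : M ⊨ T) (hH : H ⊨ T) (f : M ↪[L] H)
    (hec : ∀ (N : Type u) (_ : L.Structure N), N ⊨ T →
      ∀ (g : M ↪[L] N) (m n : ℕ) (ψ : L.BoundedFormula (Fin m) n), ψ.IsQF →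
        ∀ xs : Fin m → M, ψ.exs.Realize (⇑g ∘ xs) → ψ.exs.Realize xs) :
    ∃ (P : Type u) (_ : L.Structure P), P ⊨ T ∧
      ∃ (j : M ↪ₑ[L] P) (k : H ↪[L] P), ∀ x : M, k (f x) = j x := by
  obtain ⟨u, hu⟩ := f.exists_ultrafilter_leftInverse (hec H _ hH f)
  rcases isEmpty_or_nonempty M with hM' | hM'
  · obtain ⟨a, -⟩ := u.neBot.nonempty
    have : IsEmpty H := a.isEmpty
    exact ⟨M, _, hM, .refl L M, f.symmOfIsEmpty, fun x => isEmptyElim x⟩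
  · let j : M ↪ₑ[L] _ := Language.Ultraproduct.diagonal u
    refine ⟨_, _, (j.theory_model_iff T).1 hM, j,
      Language.Ultraproduct.embeddingOfRealizeIff u Subtype.val hu, fun x => ?_⟩
    exact Quotient.sound' (Filter.Eventually.of_forall fun a => a.2 x)
end

section
/- Let L be a first-order language, T an L-theory, and let M and H be L-structures that are models of T with an L-embedding f : M ↪[L] H. Suppose M is sententially existentially closed in Mod(T): for every L-structure N that models T and admits an L-embedding M ↪[L] N, every n : ℕ, and every quantifier-free bounded formula ψ : L.BoundedFormula Empty n, if the sentence ψ.exs holds in N then it holds in M. Then there exist an L-structure P that is elementarily equivalent to M (and hence models T) and an L-embedding k : H ↪[L] P. -/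
open FirstOrder

universe u

namespace FirstOrder.Language

open Filter BoundedFormula Structure

theorem BoundedFormula.IsAtomic.restrictFreeVar {L : Language} {α β : Type*} [DecidableEq α]
    {n : ℕ} {φ : L.BoundedFormula α n} (h : φ.IsAtomic) (f : φ.freeVarFinset → β) :
    (φ.restrictFreeVar f).IsAtomic := by
  cases h with
  | equal t₁ t₂ => exact IsAtomic.equal _ _
  | rel R ts => exact IsAtomic.rel _ _

theorem BoundedFormula.IsQF.restrictFreeVar {L : Language} {α β : Type*} [DecidableEq α]
    {n : ℕ} {φ : L.BoundedFormula α n} (h : φ.IsQF) (f : φ.freeVarFinset → β) :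
    (φ.restrictFreeVar f).IsQF := by
  induction h with
  | falsum => exact IsQF.falsum
  | of_isAtomic h => exact (h.restrictFreeVar f).isQF
  | imp _ _ ih₁ ih₂ => exact (ih₁ _).imp (ih₂ _)

/-- If every existential sentence true in `H` is true in `M`, then every quantifier-free formula
satisfiable in `H` is satisfiable in `M`. -/
theorem exists_realize_of_exs_imp {L : Language} {M H α : Type*} [Nonempty M]
    [L.Structure M] [L.Structure H]
    (hex : ∀ (n : ℕ) (ψ : L.BoundedFormula Empty n), ψ.IsQF → H ⊨ ψ.exs → M ⊨ ψ.exs)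
    {φ : L.Formula α} (hφ : φ.IsQF) {v : α → H} (hv : φ.Realize v) :
    ∃ w : α → M, φ.Realize w := by
  classical
  let e := Fintype.equivFin φ.freeVarFinset
  let χ : L.Formula (Fin _) := φ.restrictFreeVar e
  have hχ : (BoundedFormula.relabel (Sum.inr : _ → Empty ⊕ _) χ).IsQF :=
    (hφ.restrictFreeVar e).relabel _
  have hH : H ⊨ (BoundedFormula.relabel (Sum.inr : _ → Empty ⊕ _) χ).exs := by
    refine realize_exs.2 ⟨fun i => v (e.symm i), ?_⟩
    refine (Formula.realize_relabel_sumInr χ).2 ?_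
    exact (realize_restrictFreeVar v (by simp)).2 hv
  obtain ⟨xs, hxs⟩ := realize_exs.1 (hex _ _ hχ hH)
  have hxs' : χ.Realize xs := (Formula.realize_relabel_sumInr χ).1 hxs
  let w : α → M := fun a =>
    if h : a ∈ φ.freeVarFinset then xs (e ⟨a, h⟩) else Classical.choice inferInstance
  exact ⟨w, (realize_restrictFreeVar w (by simp [w])).1 hxs'⟩

/-- A map preserving the truth of all quantifier-free formulas is an embedding. -/
def Embedding.ofRealizeQF {L : Language} {H P : Type*} [L.Structure H] [L.Structure P]
    (k : H → P) (hk : ∀ φ : L.Formula H, φ.IsQF → φ.Realize id → φ.Realize k) : H ↪[L] P where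
  toFun := k
  inj' a b hab := by
    by_contra hne
    have := hk (Term.equal (var a) (var b)).not (IsAtomic.equal _ _).isQF.not
      (by simpa using hne)
    simp [hab] at this
  map_fun' F x := by
    have := hk (Term.equal (var (funMap F x)) (func F fun i => var (x i)))
      (IsAtomic.equal _ _).isQF (by simp)
    simpa [Function.comp_def] using this
  map_rel' R x := by
    refine ⟨fun h => ?_, fun h => ?_⟩
    · by_contra hne
      have := hk (R.formula fun i => var (x i)).not (IsAtomic.rel _ _).isQF.not
        (by simpa [Formula.realize_rel] using hne)
      exact this (Formula.realize_rel.2 h)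
    · simpa [Formula.realize_rel, Function.comp_def] using
        hk (R.formula fun i => var (x i)) (IsAtomic.rel _ _).isQF
          (by simpa [Formula.realize_rel] using h)

/-- If every existential sentence true in `H` is true in `M`, then `H` embeds into an ultrapower
of `M` indexed by the functions from `H` to `M`. -/
theorem exists_embedding_ultrapower_of_exs_imp {L : Language} {M H : Type*} [Nonempty M]
    [L.Structure M] [L.Structure H]
    (hex : ∀ (n : ℕ) (ψ : L.BoundedFormula Empty n), ψ.IsQF → H ⊨ ψ.exs → M ⊨ ψ.exs) :
    ∃ U : Ultrafilter (H → M),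
      Nonempty (H ↪[L] (U : Filter (H → M)).Product fun _ => M) := by
  let D := {φ : L.Formula H // φ.IsQF ∧ φ.Realize (id : H → H)}
  let S : D → Filter (H → M) := fun φ => 𝓟 {g | φ.1.Realize g}
  have : Nonempty D := ⟨⟨⊤, IsQF.top, by simp⟩⟩
  have hS : Directed (· ≥ ·) S := fun φ ψ =>
    ⟨⟨φ.1 ⊓ ψ.1, φ.2.1.inf ψ.2.1, Formula.realize_inf.2 ⟨φ.2.2, ψ.2.2⟩⟩,
      principal_mono.2 fun _ hg => (Formula.realize_inf.1 hg).1,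
      principal_mono.2 fun _ hg => (Formula.realize_inf.1 hg).2⟩
  have hne : (iInf S).NeBot := iInf_neBot_of_directed' hS fun φ =>
    principal_neBot_iff.2 (exists_realize_of_exs_imp hex φ.2.1 φ.2.2)
  refine ⟨Ultrafilter.of (iInf S), ⟨Embedding.ofRealizeQF
    (fun h => ((fun g => g h : (H → M) → M) : Filter.Product _ _)) fun φ hφ hφH => ?_⟩⟩
  refine (Ultraproduct.realize_formula_cast φ _).2 ?_
  exact (Ultrafilter.of_le _).trans (iInf_le S ⟨φ, hφ, hφH⟩) (mem_principal_self _)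

/-- An empty structure embeds into any of its substructures. -/
def Embedding.ofIsEmpty {L : Language} {M H : Type*} [L.Structure M] [L.Structure H] [IsEmpty H]
    (f : M ↪[L] H) : H ↪[L] M where
  toFun := isEmptyElim
  inj' := isEmptyElim
  map_fun' F x := isEmptyElim (funMap F x)
  map_rel' R x := by
    rw [← f.map_rel]
    exact iff_of_eq (congrArg _ (funext fun i => isEmptyElim (x i)))

end FirstOrder.Language

theorem sententiallyExistentiallyClosed_extension {L : Language} {M H : Type u}
    [L.Structure M] [L.Structure H] {T : L.Theory}
    (hM : M ⊨ T) (hH : H ⊨ T) (f : M ↪[L] H)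
    (hsec : ∀ (N : Type u) (_ : L.Structure N), N ⊨ T → Nonempty (M ↪[L] N) →
      ∀ (n : ℕ) (ψ : L.BoundedFormula Empty n), ψ.IsQF →
        N ⊨ ψ.exs → M ⊨ ψ.exs) :
    ∃ (P : Type u) (_ : L.Structure P), (M ≅[L] P) ∧ Nonempty (H ↪[L] P) := by
  have hex := hsec H inferInstance hH ⟨f⟩
  rcases isEmpty_or_nonempty H with hE | ⟨⟨a⟩⟩
  · exact ⟨M, inferInstance, rfl, ⟨f.ofIsEmpty⟩⟩
  have : Nonempty M := by
    obtain ⟨xs, -⟩ := Language.BoundedFormula.realize_exs.1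
      (hex 1 ⊤ .top (Language.BoundedFormula.realize_exs.2 ⟨fun _ => a, by simp⟩))
    exact ⟨xs 0⟩
  obtain ⟨U, hU⟩ := Language.exists_embedding_ultrapower_of_exs_imp hex
  refine ⟨_, inferInstance, ?_, hU⟩
  rw [Language.elementarilyEquivalent_iff]
  intro φ
  simp [Language.Ultraproduct.sentence_realize]
end
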